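/- Let $1\le p<u<\infty$. Then the topological dual of $m^{00}_{u,p}(\mathbb{Z}^d)$ is isometrically isomorphic to $\mathcal{X}_{u,p}(\mathbb{Z}^d)$: every bounded linear functional $f$ on $m^{00}_{u,p}(\mathbb{Z}^d)$ has a unique representation $f(\lambda)=\sum_{k\in\mathbb{Z}^d}\lambda_k\mu_k$ with $\mu\in\mathcal{X}_{u,p}(\mathbb{Z}^d)$ and $\|f\|=\|\mu\,|\,\mathcal{X}_{u,p}\|$, and conversely every $\mu\in\mathcal{X}_{u,p}(\mathbb{Z}^d)$ defines such a functional with this norm. -/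

import Mathlib

open scoped ENNReal NNReal BigOperators
open Filter

/-- The unit cube `Q_{0,k}` is contained in the dyadic cube `Q_{-j,m}` of side length `2^j`. -/
def inDyadic (d j : ℕ) (m k : Fin d → ℤ) : Prop :=
  ∀ i, 2 ^ j * m i ≤ k i ∧ k i < 2 ^ j * (m i + 1)

/-- The Morrey sequence space quasi-norm `‖λ | m_{u,p}(ℤ^d)‖`, with values in `ℝ≥0∞`. -/
noncomputable def morreyNorm (d : ℕ) (u p : ℝ) (lam : (Fin d → ℤ) → ℂ) : ℝ≥0∞ :=
  ⨆ (j : ℕ) (m : Fin d → ℤ),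
    ((2 : ℝ≥0∞) ^ (j * d)) ^ (1 / u - 1 / p) *
      (∑' k : {k : Fin d → ℤ // inDyadic d j m k}, (‖lam k.1‖₊ : ℝ≥0∞) ^ p) ^ (1 / p)

/-- The `ℓ_r(ℤ^d)` norm. -/
noncomputable def lpNorm (d : ℕ) (r : ℝ) (lam : (Fin d → ℤ) → ℂ) : ℝ≥0∞ :=
  (∑' k : Fin d → ℤ, (‖lam k‖₊ : ℝ≥0∞) ^ r) ^ (1 / r)

/-- The `ℓ_∞(ℤ^d)` norm. -/
noncomputable def lInftyNorm (d : ℕ) (lam : (Fin d → ℤ) → ℂ) : ℝ≥0∞ :=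
  ⨆ k : Fin d → ℤ, (‖lam k‖₊ : ℝ≥0∞)

/-- The weak Lorentz `ℓ_{u,∞}(ℤ^d)` norm, via the distribution function. -/
noncomputable def weakNorm (d : ℕ) (u : ℝ) (lam : (Fin d → ℤ) → ℂ) : ℝ≥0∞ :=
  ⨆ t : ℝ≥0, (t : ℝ≥0∞) *
    (∑' _ : {k : Fin d → ℤ // (t : ℝ) < ‖lam k‖}, (1 : ℝ≥0∞)) ^ (1 / u)

/-- The norm of the level-`j` space `X^{(j)}_{u,p}(ℤ^d)`. -/
noncomputable def XjNorm (d : ℕ) (u p p' : ℝ) (j : ℕ) (lam : (Fin d → ℤ) → ℂ) : ℝ≥0∞ :=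
  ((2 : ℝ≥0∞) ^ (j * d)) ^ (1 / p - 1 / u) *
    ∑' m : Fin d → ℤ,
      (∑' k : {k : Fin d → ℤ // inDyadic d j m k}, (‖lam k.1‖₊ : ℝ≥0∞) ^ p') ^ (1 / p')

/-- The norm of `X_{u,p}(ℤ^d)`: infimum over decompositions `λ = ∑_j λ^{(j)}`. -/
noncomputable def XupNorm (d : ℕ) (u p p' : ℝ) (lam : (Fin d → ℤ) → ℂ) : ℝ≥0∞ :=
  ⨅ (L : ℕ → (Fin d → ℤ) → ℂ) (_ : ∀ k, HasSum (fun j => L j k) (lam k)),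
    ∑' j : ℕ, XjNorm d u p p' j (L j)

/-- Membership in `m_{u,p}(ℤ^d)`. -/
def MemMorrey (d : ℕ) (u p : ℝ) (lam : (Fin d → ℤ) → ℂ) : Prop :=
  morreyNorm d u p lam ≠ ⊤

/-- Membership in `m^{00}_{u,p}(ℤ^d)`, the closure of the finitely supported sequences. -/
def MemMorrey00 (d : ℕ) (u p : ℝ) (lam : (Fin d → ℤ) → ℂ) : Prop :=
  MemMorrey d u p lam ∧
    ∀ ε : ℝ≥0∞, 0 < ε → ∃ mu : (Fin d → ℤ) → ℂ,
      (Function.support mu).Finite ∧ morreyNorm d u p (lam - mu) < ε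

/-- `Q_{-ν,m} ⊆ Q_{-j,0}` for dyadic cubes. -/
def subCube (d j ν : ℕ) (m : Fin d → ℤ) : Prop :=
  ν ≤ j ∧ ∀ i, 0 ≤ m i ∧ 2 ^ ν * (m i + 1) ≤ 2 ^ j

/-- Norm of the finite-dimensional Morrey space `m^{2^{jd}}_{u,p}` on the cube `Q_{-j,0}`. -/
noncomputable def finMorreyNorm (d : ℕ) (u p : ℝ) (j : ℕ) (lam : (Fin d → ℤ) → ℂ) : ℝ≥0∞ :=
  ⨆ (ν : ℕ) (m : Fin d → ℤ) (_ : subCube d j ν m),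
    ((2 : ℝ≥0∞) ^ (ν * d)) ^ (1 / u - 1 / p) *
      (∑' k : {k : Fin d → ℤ // inDyadic d ν m k}, (‖lam k.1‖₊ : ℝ≥0∞) ^ p) ^ (1 / p)

/-- Operator norm of `id_j : m^{2^{jd}}_{u₁,p₁} → m^{2^{jd}}_{u₂,p₂}`. -/
noncomputable def morreyOpNorm (d : ℕ) (u₁ p₁ u₂ p₂ : ℝ) (j : ℕ) : ℝ≥0∞ :=
  ⨆ (lam : (Fin d → ℤ) → ℂ) (_ : finMorreyNorm d u₁ p₁ j lam ≤ 1),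
    finMorreyNorm d u₂ p₂ j lam


theorem morrey_abstract_dual {I K : Type*} (S : I → Set K) [hS : ∀ q, Fintype (S q)]
    (p p' : ℝ) (hpq : p.HolderConjugate p') (w : I → ℝ) (hw0 : ∀ q, 0 < w q) (hw1 : ∀ q, w q ≤ 1)
    (hcov : ∀ k : K, ∃ q, k ∈ S q)
    (mu : K → ℂ) (C : ℝ) (hC : 0 ≤ C)
    (h : ∀ (lam : K →₀ ℂ) (A : ℝ), (∀ q, w q * (∑ k : S q, ‖lam k‖ ^ p) ^ (1 / p) ≤ A) →
      ‖lam.sum (fun k z => z * mu k)‖ ≤ C * A) :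
    ∃ ν : I → K → ℂ,
      (∀ A : Finset I, ∑ q ∈ A, (∑ k : S q, ‖ν q k‖₊ ^ p') ^ (1 / p') ≤ C) ∧
      ∀ (k : K) (s : ℕ → I), Function.Injective s → (∀ q, k ∈ S q ↔ q ∈ Set.range s) →
        Summable (fun j => w (s j)) → HasSum (fun j => (w (s j) : ℂ) * ν (s j) k) (mu k) := by
  classical
  have hp1 : 1 ≤ p := hpq.lt.le
  have hp0 : 0 < p := hpq.pos
  set P : ℝ≥0∞ := ENNReal.ofReal p with hP
  have hPr : P.toReal = p := ENNReal.toReal_ofReal hp0.le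
  have : Fact (1 ≤ P) := ⟨by rw [hP, ← ENNReal.ofReal_one]; exact ENNReal.ofReal_le_ofReal hp1⟩
  let E : I → Type _ := fun q => PiLp P (fun _ : S q => ℂ)
  let _ : ∀ q, NormedAddCommGroup (E q) := fun q => inferInstanceAs (NormedAddCommGroup (PiLp P (fun _ : S q => ℂ)))
  let _ : ∀ q, NormedSpace ℂ (E q) := fun q => inferInstanceAs (NormedSpace ℂ (PiLp P (fun _ : S q => ℂ)))
  have hnorm : ∀ q (x : E q), ‖x‖ = (∑ k : S q, ‖x k‖ ^ p) ^ (1 / p) := by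
    intro q x
    have := PiLp.norm_eq_sum (p := P) (β := fun _ : S q => ℂ) (by rw [hPr]; exact hp0) x
    rw [hPr] at this
    exact this
  -- the embedding
  have hmem : ∀ lam : K →₀ ℂ, Memℓp (E := E)
      (fun q => (WithLp.toLp P (fun k : S q => (w q : ℂ) * lam k) : E q)) ∞ := by
    intro lam
    refine memℓp_infty ⟨(∑ k ∈ lam.support, ‖lam k‖ ^ p) ^ (1 / p), ?_⟩
    rintro _ ⟨q, rfl⟩
    simp only
    rw [hnorm]
    refine Real.rpow_le_rpow (by positivity) ?_ (by positivity)
    calc ∑ k : S q, ‖(w q : ℂ) * lam k‖ ^ p ≤ ∑ k : S q, ‖lam k‖ ^ p := by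
          refine Finset.sum_le_sum fun k _ => Real.rpow_le_rpow (norm_nonneg _) ?_ hp0.le
          rw [norm_mul, Complex.norm_real, Real.norm_of_nonneg (hw0 q).le]
          exact mul_le_of_le_one_left (norm_nonneg _) (hw1 q)
      _ = ∑ k ∈ (S q).toFinset, ‖lam k‖ ^ p := by
          exact Finset.sum_set_coe (S q) (f := fun k => ‖lam k‖ ^ p)
      _ ≤ ∑ k ∈ (S q).toFinset ∪ lam.support, ‖lam k‖ ^ p :=
          Finset.sum_le_sum_of_subset_of_nonneg Finset.subset_union_left
            (fun _ _ _ => by positivity)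
      _ = ∑ k ∈ lam.support, ‖lam k‖ ^ p := by
          symm
          refine Finset.sum_subset Finset.subset_union_right fun k _ hk => ?_
          rw [Finsupp.notMem_support_iff.1 hk, norm_zero, Real.zero_rpow hp0.ne']
  let T : (K →₀ ℂ) →ₗ[ℂ] lp E ∞ :=
    { toFun := fun lam => ⟨_, hmem lam⟩
      map_add' := by
        intro x y
        ext q k
        change (w q : ℂ) * (x k + y k) = (w q : ℂ) * x k + (w q : ℂ) * y k
        ring
      map_smul' := by
        intro c x
        ext q k
        change (w q : ℂ) * (c * x k) = c * ((w q : ℂ) * x k)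
        ring }
  have hT : ∀ lam q (k : S q), (T lam q : E q) k = (w q : ℂ) * lam k := fun _ _ _ => rfl
  have hTn : ∀ lam q, ‖T lam q‖ = w q * (∑ k : S q, ‖lam k‖ ^ p) ^ (1 / p) := by
    intro lam q
    rw [hnorm]
    simp only [hT, norm_mul, Complex.norm_real, Real.norm_of_nonneg (hw0 q).le]
    simp_rw [Real.mul_rpow (hw0 q).le (norm_nonneg _)]
    rw [← Finset.mul_sum, Real.mul_rpow (by have := hw0 q; positivity) (by positivity),
      ← Real.rpow_mul (hw0 q).le, mul_one_div_cancel hp0.ne', Real.rpow_one]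
  have hTinj : Function.Injective T := by
    intro x y hxy
    ext k
    obtain ⟨q, hq⟩ := hcov k
    have h1 := hT x q ⟨k, hq⟩
    have h2 := hT y q ⟨k, hq⟩
    rw [hxy, h2] at h1
    exact (mul_left_cancel₀ (Complex.ofReal_ne_zero.2 (hw0 q).ne') h1).symm
  let φ : (K →₀ ℂ) →ₗ[ℂ] ℂ := Finsupp.linearCombination ℂ mu
  have hφ : ∀ lam, φ lam = lam.sum (fun k z => z * mu k) := fun lam => rfl
  let e := LinearEquiv.ofInjective T hTinj
  let G : StrongDual ℂ (LinearMap.range T) :=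
    LinearMap.mkContinuous (φ.comp e.symm.toLinearMap) C (by
      intro x
      obtain ⟨lam, rfl⟩ := e.surjective x
      have : (φ.comp e.symm.toLinearMap) (e lam) = φ lam := by simp
      rw [this, hφ]
      refine h lam _ fun q => ?_
      rw [← hTn]
      exact lp.norm_apply_le_norm (by simp) (T lam) q)
  obtain ⟨F, hF, hFn⟩ := exists_extension_norm_eq (LinearMap.range T) G
  have hFC : ‖F‖ ≤ C := hFn ▸ LinearMap.mkContinuous_norm_le _ hC _
  have hFT : ∀ lam, F (T lam) = φ lam := by
    intro lam
    have := hF (e lam)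
    have h2 : G (e lam) = φ lam := by
      change φ (e.symm (e lam)) = φ lam
      simp
    rw [← h2, ← this]
    rfl
  let b : I → K → lp E ∞ := fun q k =>
    lp.single ∞ q (WithLp.toLp P (fun k' : S q => if k'.1 = k then (1 : ℂ) else 0) : E q)
  have hb : ∀ q k q' (k' : S q'), (b q k q' : E q') k' = if q' = q ∧ k'.1 = k then 1 else 0 := by
    intro q k q' k'
    by_cases hq : q' = q
    · subst hq
      simp only [b, lp.single_apply_self]
      simp
    · simp only [b, lp.single_apply_ne _ _ _ hq]
      simp [hq]
  refine ⟨fun q k => F (b q k), ?_, ?_⟩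
  · intro A
    choose g hg hg2 using fun q => (NNReal.isGreatest_Lp (Finset.univ : Finset (S q))
      (fun k => ‖F (b q k)‖₊) hpq.symm).1
    let c : ∀ q, S q → ℂ := fun q k => (starRingEnd ℂ (F (b q k)) / ‖F (b q k)‖) * (g q k : ℝ)
    have hc : ∀ q k, c q k * F (b q k) = ((‖F (b q k)‖₊ * g q k : ℝ≥0) : ℂ) := by
      intro q k
      by_cases h0 : F (b q k) = 0
      · simp [c, h0]
      · have h1 : (‖F (b q k)‖ : ℂ) ≠ 0 := by simpa using h0
        have h3 := Complex.conj_mul' (F (b q k))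
        simp only [c, NNReal.coe_mul, Complex.ofReal_mul, coe_nnnorm]
        calc _ = (starRingEnd ℂ (F (b q k)) * F (b q k)) / ‖F (b q k)‖ * (g q k : ℝ) := by ring
          _ = _ := by rw [h3]; field_simp
    have hcn : ∀ q k, ‖c q k‖ ≤ g q k := by
      intro q k
      simp only [c, norm_mul, norm_div, Complex.norm_real, norm_norm, RCLike.norm_conj]
      simp only [NNReal.norm_eq]
      exact mul_le_of_le_one_left (g q k).2 (div_self_le_one _)
    let x : lp E ∞ := ∑ q ∈ A, ∑ k : S q, c q k • b q k
    have hx : ‖x‖ ≤ 1 := by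
      refine lp.norm_le_of_forall_le zero_le_one fun q' => ?_
      have hxq : ∀ k' : S q', (x q' : E q') k' = if q' ∈ A then c q' k' else 0 := by
        intro k'
        have : (x q' : E q') k' = ∑ q ∈ A, ∑ k : S q, c q k * (b q k q' : E q') k' := by
          simp only [x, lp.coeFn_sum, Finset.sum_apply]
          have h1 : ∀ (ι : Type _) (s : Finset ι) (f : ι → E q'), (∑ i ∈ s, f i) k' = ∑ i ∈ s, f i k' := by
            intro ι s f
            exact map_sum (PiLp.proj P (𝕜 := ℂ) (fun _ : S q' => ℂ) k') f s
          rw [h1]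
          refine Finset.sum_congr rfl fun q _ => ?_
          have h1 : ∀ (ι : Type _) (s : Finset ι) (f : ι → E q'), (∑ i ∈ s, f i) k' = ∑ i ∈ s, f i k' := by
            intro ι s f
            exact map_sum (PiLp.proj P (𝕜 := ℂ) (fun _ : S q' => ℂ) k') f s
          rw [h1]
          rfl
        rw [this]
        simp only [hb]
        by_cases hA : q' ∈ A
        · rw [if_pos hA, Finset.sum_eq_single q' _ (by simp [hA])]
          · rw [Finset.sum_eq_single k' _ (by simp)]
            · simp
            · intro k _ hk
              have hk2 : k'.1 ≠ k.1 := fun h' => hk (Subtype.ext h'.symm)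
              simp [hk2]
          · intro q _ hq
            simp [hq.symm]
        · rw [if_neg hA]
          refine Finset.sum_eq_zero fun q hq => Finset.sum_eq_zero fun k _ => ?_
          have : q' ≠ q := fun h' => hA (h' ▸ hq)
          simp [this]
      rw [hnorm]
      refine Real.rpow_le_one (by positivity) ?_ (by positivity)
      have h1 : ∑ k : S q', (g q' k : ℝ) ^ p ≤ 1 := by exact_mod_cast hg q'
      refine le_trans (Finset.sum_le_sum fun k _ => ?_) h1
      refine Real.rpow_le_rpow (norm_nonneg _) ?_ hp0.le
      rw [hxq]
      split_ifs
      · exact hcn _ _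
      · simp
    have hFx : F x = ((∑ q ∈ A, (∑ k : S q, ‖F (b q k)‖₊ ^ p') ^ (1 / p') : ℝ≥0) : ℂ) := by
      simp only [x, map_sum, map_smul, smul_eq_mul, hc]
      rw [NNReal.coe_sum, Complex.ofReal_sum]
      refine Finset.sum_congr rfl fun q _ => ?_
      rw [← hg2 q]
      simp
    have h1 : ‖F x‖ ≤ C := (F.le_opNorm x).trans
      ((mul_le_of_le_one_right (norm_nonneg _) hx).trans hFC)
    rw [hFx, Complex.norm_real, NNReal.norm_eq] at h1
    push_cast at h1 ⊢
    exact h1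
  · intro k s hs hks hsum
    have hbn : ∀ q, ‖b q k‖ ≤ 1 := by
      intro q
      refine lp.norm_le_of_forall_le zero_le_one fun q' => ?_
      rw [hnorm]
      refine Real.rpow_le_one (by positivity) ?_ (by positivity)
      calc ∑ k' : S q', ‖(b q k q' : E q') k'‖ ^ p ≤ ∑ k' : S q', if k'.1 = k then 1 else 0 := by
            refine Finset.sum_le_sum fun k' _ => ?_
            rw [hb]
            by_cases h1 : k'.1 = k <;> by_cases h2 : q' = q <;> simp [h1, h2, hp0.ne']
        _ ≤ 1 := by
            rw [Finset.sum_ite, Finset.sum_const_zero, add_zero, Finset.sum_const, nsmul_eq_mul, mul_one]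
            norm_cast
            refine Finset.card_le_one.2 fun x hx y hy => Subtype.ext ?_
            simp at hx hy
            rw [hx, hy]
    have hsm : Summable (fun j => (w (s j) : ℂ) • b (s j) k) := by
      refine Summable.of_norm_bounded hsum fun j => ?_
      rw [norm_smul, Complex.norm_real, Real.norm_of_nonneg (hw0 _).le]
      exact mul_le_of_le_one_right (hw0 _).le (hbn _)
    have hlim : HasSum (fun j => (w (s j) : ℂ) • b (s j) k) (T (Finsupp.single k 1)) := by
      convert hsm.hasSum using 1
      ext q k'
      have h1 := (hsm.hasSum.mapL (lp.evalCLM ℂ E ∞ q)).mapL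
        (PiLp.proj P (𝕜 := ℂ) (fun _ : S q => ℂ) k')
      refine HasSum.unique ?_ h1
      have h2 : ∀ j, (PiLp.proj P (𝕜 := ℂ) (fun _ : S q => ℂ) k')
          ((lp.evalCLM ℂ E ∞ q) ((w (s j) : ℂ) • b (s j) k)) =
          (w (s j) : ℂ) * (if q = s j ∧ k'.1 = k then 1 else 0) := by
        intro j
        rw [← hb]
        rfl
      simp only [h2, hT]
      by_cases hk : k'.1 = k
      · obtain ⟨j0, hj0⟩ := (hks q).1 (hk ▸ k'.2)
        convert hasSum_single j0 _ using 1
        · simp [hk, hj0]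
        · intro j hj
          have : q ≠ s j := fun h' => hj (hs (h' ▸ hj0)).symm
          simp [this]
      · simp only [hk, and_false, if_false, mul_zero]
        rw [Finsupp.single_eq_of_ne hk, mul_zero]
        exact hasSum_zero
    have h3 := hlim.mapL F
    rw [hFT, hφ] at h3
    simpa using h3

theorem inDyadic_iff (d j : ℕ) (m k : Fin d → ℤ) :
    inDyadic d j m k ↔ (fun i => k i / 2 ^ j) = m := by
  rw [funext_iff]
  refine forall_congr' fun i => ?_
  have h2 : (0 : ℤ) < 2 ^ j := by positivity
  constructor
  · rintro ⟨h, h'⟩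
    refine le_antisymm (Int.lt_add_one_iff.1 ?_) ?_
    · exact Int.ediv_lt_of_lt_mul h2 (by linarith)
    · exact Int.le_ediv_of_mul_le h2 (by linarith)
  · intro h
    rw [← h]
    exact ⟨Int.mul_ediv_self_le h2.ne', by rw [mul_add, mul_one]; exact Int.lt_mul_ediv_self_add h2⟩

theorem inDyadic_finite (d j : ℕ) (m : Fin d → ℤ) : {k | inDyadic d j m k}.Finite :=
  (Set.finite_Icc (fun i => 2 ^ j * m i) (fun i => 2 ^ j * (m i + 1))).subset
    fun _ hk => ⟨fun i => (hk i).1, fun i => (hk i).2.le⟩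

noncomputable instance inDyadicFintype (d j : ℕ) (m : Fin d → ℤ) :
    Fintype {k // inDyadic d j m k} := (inDyadic_finite d j m).fintype

theorem tsum_dyadic (d j : ℕ) (g : (Fin d → ℤ) → ℝ≥0∞) :
    ∑' k, g k = ∑' m : Fin d → ℤ, ∑' k : {k // inDyadic d j m k}, g k := by
  rw [← ENNReal.tsum_fiberwise g (fun k i => k i / 2 ^ j)]
  refine tsum_congr fun m => ?_
  exact (Equiv.subtypeEquivRight (p := fun k => inDyadic d j m k)
    (q := fun k => k ∈ (fun (k : Fin d → ℤ) i => k i / 2 ^ j) ⁻¹' {m})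
    (fun k => inDyadic_iff d j m k)).tsum_eq (fun k => g k.1) |>.symm

theorem weight_mul (d j : ℕ) (u p : ℝ) :
    ((2 : ℝ≥0∞) ^ (j * d)) ^ (1 / u - 1 / p) * ((2 : ℝ≥0∞) ^ (j * d)) ^ (1 / p - 1 / u) = 1 := by
  rw [← ENNReal.rpow_add _ _ (by simp) (ENNReal.pow_ne_top (by simp))]
  simp

theorem level_holder (d j : ℕ) (u p p' : ℝ) (hpq : p.HolderConjugate p')
    (lam x : (Fin d → ℤ) → ℂ) :
    ∑' k, ‖lam k‖ₑ * ‖x k‖ₑ ≤ morreyNorm d u p lam * XjNorm d u p p' j x := by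
  rw [tsum_dyadic d j]
  unfold XjNorm
  rw [← mul_assoc, ← ENNReal.tsum_mul_left]
  refine ENNReal.tsum_le_tsum fun m => ?_
  have h1 : ∑' k : {k // inDyadic d j m k}, ‖lam k‖ₑ * ‖x k‖ₑ ≤
      (∑' k : {k // inDyadic d j m k}, (‖lam k.1‖₊ : ℝ≥0∞) ^ p) ^ (1 / p) *
      (∑' k : {k // inDyadic d j m k}, (‖x k.1‖₊ : ℝ≥0∞) ^ p') ^ (1 / p') := by
    simp only [tsum_fintype]
    exact ENNReal.inner_le_Lp_mul_Lq _ _ _ hpq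
  refine h1.trans ?_
  gcongr
  have h2 : ((2 : ℝ≥0∞) ^ (j * d)) ^ (1 / u - 1 / p) *
      (∑' k : {k : Fin d → ℤ // inDyadic d j m k}, (‖lam k.1‖₊ : ℝ≥0∞) ^ p) ^ (1 / p)
      ≤ morreyNorm d u p lam := by
    unfold morreyNorm
    exact le_iSup₂ (f := fun (j : ℕ) (m : Fin d → ℤ) => ((2 : ℝ≥0∞) ^ (j * d)) ^ (1 / u - 1 / p) *
      (∑' k : {k : Fin d → ℤ // inDyadic d j m k}, (‖lam k.1‖₊ : ℝ≥0∞) ^ p) ^ (1 / p)) j m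
  calc _ = (((2 : ℝ≥0∞) ^ (j * d)) ^ (1 / u - 1 / p) * ((2 : ℝ≥0∞) ^ (j * d)) ^ (1 / p - 1 / u)) *
      (∑' k : {k : Fin d → ℤ // inDyadic d j m k}, (‖lam k.1‖₊ : ℝ≥0∞) ^ p) ^ (1 / p) := by
        rw [weight_mul, one_mul]
    _ = (((2 : ℝ≥0∞) ^ (j * d)) ^ (1 / u - 1 / p) *
      (∑' k : {k : Fin d → ℤ // inDyadic d j m k}, (‖lam k.1‖₊ : ℝ≥0∞) ^ p) ^ (1 / p)) *
        ((2 : ℝ≥0∞) ^ (j * d)) ^ (1 / p - 1 / u) := by ring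
    _ ≤ _ := by gcongr

theorem dual_bound (d : ℕ) (u p p' : ℝ) (hpq : p.HolderConjugate p')
    (lam mu : (Fin d → ℤ) → ℂ) (hlam : morreyNorm d u p lam ≠ ⊤) (hmu : XupNorm d u p p' mu ≠ ⊤) :
    ∑' k, ‖lam k * mu k‖ₑ ≤ XupNorm d u p p' mu * morreyNorm d u p lam := by
  have main : ∀ L : ℕ → (Fin d → ℤ) → ℂ, (∀ k, HasSum (fun j => L j k) (mu k)) →
      ∑' k, ‖lam k * mu k‖ₑ ≤ (∑' j, XjNorm d u p p' j (L j)) * morreyNorm d u p lam := by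
    intro L hL
    calc ∑' k, ‖lam k * mu k‖ₑ ≤ ∑' k, ∑' j, ‖lam k‖ₑ * ‖L j k‖ₑ := by
          refine ENNReal.tsum_le_tsum fun k => ?_
          rw [enorm_mul, ENNReal.tsum_mul_left]
          gcongr
          rw [← (hL k).tsum_eq]
          exact enorm_tsum_le_tsum_enorm
      _ = ∑' j, ∑' k, ‖lam k‖ₑ * ‖L j k‖ₑ := ENNReal.tsum_comm
      _ ≤ ∑' j, morreyNorm d u p lam * XjNorm d u p p' j (L j) :=
          ENNReal.tsum_le_tsum fun j => level_holder d j u p p' hpq lam (L j)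
      _ = _ := by rw [ENNReal.tsum_mul_left, mul_comm]
  by_cases h0 : morreyNorm d u p lam = 0
  · have : ∃ L : ℕ → (Fin d → ℤ) → ℂ, ∀ k, HasSum (fun j => L j k) (mu k) := by
      by_contra hcon
      push Not at hcon
      apply hmu
      unfold XupNorm
      refine iInf₂_eq_top.2 fun L hL => ?_
      obtain ⟨k, hk⟩ := hcon L
      exact absurd (hL k) hk
    obtain ⟨L, hL⟩ := this
    simpa [h0] using main L hL
  · rw [← ENNReal.div_le_iff h0 hlam]
    unfold XupNorm
    refine le_iInf₂ fun L hL => ?_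
    rw [ENNReal.div_le_iff h0 hlam]
    exact main L hL

theorem morrey_finite (d : ℕ) (u p : ℝ) (hp : 0 < p) (hpu : p < u) (lam : (Fin d → ℤ) → ℂ)
    (hl : (Function.support lam).Finite) : morreyNorm d u p lam ≠ ⊤ := by
  have hle : morreyNorm d u p lam ≤ (∑ k ∈ hl.toFinset, ‖lam k‖ₑ ^ p) ^ (1 / p) := by
    unfold morreyNorm
    refine iSup₂_le fun j m => ?_
    have h1 : ((2 : ℝ≥0∞) ^ (j * d)) ^ (1 / u - 1 / p) ≤ 1 := by
      refine ENNReal.rpow_le_one_of_one_le_of_neg (one_le_pow₀ (by norm_num)) ?_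
      have := one_div_lt_one_div_of_lt hp hpu
      linarith
    refine (mul_le_of_le_one_left' h1).trans ?_
    refine ENNReal.rpow_le_rpow ?_ (by positivity)
    calc _ ≤ ∑' k, ‖lam k‖ₑ ^ p :=
          ENNReal.tsum_comp_le_tsum_of_injective Subtype.val_injective (fun k => ‖lam k‖ₑ ^ p)
      _ = _ := by
          refine tsum_eq_sum fun k hk => ?_
          have : lam k = 0 := by simpa using hk
          simp [this, hp]
  refine ne_top_of_le_ne_top ?_ hle
  refine ENNReal.rpow_ne_top_of_nonneg (by positivity) ?_
  refine ENNReal.sum_ne_top.2 fun k _ => ENNReal.rpow_ne_top_of_nonneg hp.le enorm_ne_top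

theorem morrey_zero (d : ℕ) (u p : ℝ) (hp : 0 < p) : morreyNorm d u p 0 = 0 := by
  simp [morreyNorm, hp]

theorem mem00_finite (d : ℕ) (u p : ℝ) (hp : 0 < p) (hpu : p < u) (lam : (Fin d → ℤ) → ℂ)
    (hl : (Function.support lam).Finite) : MemMorrey00 d u p lam :=
  ⟨morrey_finite d u p hp hpu lam hl, fun ε hε => ⟨lam, hl, by
    rw [sub_self, morrey_zero d u p hp]; exact hε⟩⟩

theorem mem00_sub (d : ℕ) (u p : ℝ) (lam x : (Fin d → ℤ) → ℂ) (hlam : MemMorrey00 d u p lam)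
    (hx : (Function.support x).Finite) (hfin : morreyNorm d u p (lam - x) ≠ ⊤) :
    MemMorrey00 d u p (lam - x) := by
  refine ⟨hfin, fun ε hε => ?_⟩
  obtain ⟨y, hy, hy2⟩ := hlam.2 ε hε
  refine ⟨y - x, (hy.union hx).subset (Function.support_sub y x), ?_⟩
  rwa [sub_sub_sub_cancel_right]

theorem morrey_term (d j : ℕ) (u p : ℝ) (hp : 0 < p) (m : Fin d → ℤ) (lam : (Fin d → ℤ) → ℂ) :
    ((2 : ℝ≥0∞) ^ (j * d)) ^ (1 / u - 1 / p) *
      (∑' k : {k : Fin d → ℤ // inDyadic d j m k}, (‖lam k.1‖₊ : ℝ≥0∞) ^ p) ^ (1 / p) =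
    ENNReal.ofReal (((2 : ℝ) ^ (j * d)) ^ (1 / u - 1 / p) *
      (∑ k : {k : Fin d → ℤ // inDyadic d j m k}, ‖lam k.1‖ ^ p) ^ (1 / p)) := by
  rw [ENNReal.ofReal_mul (by positivity), ← ENNReal.ofReal_rpow_of_pos (by positivity),
    ENNReal.ofReal_pow (by positivity), ← ENNReal.ofReal_rpow_of_nonneg (by positivity) (by positivity),
    ENNReal.ofReal_sum_of_nonneg (fun _ _ => by positivity), tsum_fintype]
  simp only [ENNReal.ofReal_ofNat]
  congr 2
  refine Finset.sum_congr rfl fun k _ => ?_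
  rw [← ENNReal.ofReal_rpow_of_nonneg (norm_nonneg _) hp.le, ofReal_norm]
  rfl

theorem dual_key (d : ℕ) (u p p' : ℝ) (hpq : p.HolderConjugate p') (hpu : p < u)
    (mu : (Fin d → ℤ) → ℂ) (C : ℝ≥0∞)
    (h : ∀ lam : (Fin d → ℤ) →₀ ℂ, ‖lam.sum (fun k z => z * mu k)‖ₑ ≤ C * morreyNorm d u p lam) :
    XupNorm d u p p' mu ≤ C := by
  have hp0 : 0 < p := hpq.pos
  have hp'0 : 0 < p' := hpq.symm.pos
  have hexp : 1 / u - 1 / p < 0 := by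
    have := one_div_lt_one_div_of_lt hp0 hpu
    linarith
  rcases Nat.eq_zero_or_pos d with rfl | hd
  · -- a single point
    have h1 := h (Finsupp.single 0 1)
    have h2 : morreyNorm 0 u p (Finsupp.single (0 : Fin 0 → ℤ) (1 : ℂ)) ≤ 1 := by
      unfold morreyNorm
      refine iSup₂_le fun j m => ?_
      rw [morrey_term _ _ _ _ hp0, ← ENNReal.ofReal_one]
      refine ENNReal.ofReal_le_ofReal ?_
      simp only [mul_zero, pow_zero, Real.one_rpow, one_mul]
      refine Real.rpow_le_one (by positivity) ?_ (by positivity)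
      refine (Finset.sum_le_card_nsmul _ _ 1 fun k _ => ?_).trans ?_
      · have : k.1 = 0 := Subsingleton.elim _ _
        simp [this]
      · simp only [nsmul_eq_mul, mul_one]
        norm_cast
        exact Finset.card_le_one.2 fun a _ b _ => Subsingleton.elim _ _
    have h3 : ‖mu 0‖ₑ ≤ C := by
      have : ‖mu 0‖ₑ ≤ C * morreyNorm 0 u p (Finsupp.single (0 : Fin 0 → ℤ) (1 : ℂ)) := by
        simpa using h1
      exact this.trans (mul_le_of_le_one_right' h2)
    refine le_trans ?_ h3
    unfold XupNorm
    refine iInf₂_le_of_le (fun j k => if j = 0 then mu k else 0) (fun k => ?_) ?_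
    · exact hasSum_ite_eq 0 (mu k)
    · rw [tsum_eq_single 0]
      · unfold XjNorm
        simp only [zero_mul, pow_zero, ENNReal.one_rpow, one_mul, if_true]
        rw [tsum_eq_single 0 (fun b hb => absurd (Subsingleton.elim _ _) hb), tsum_fintype]
        rw [show ‖mu 0‖ₑ = (‖mu 0‖ₑ ^ p') ^ (1 / p') by
          rw [← ENNReal.rpow_mul, mul_one_div_cancel hp'0.ne', ENNReal.rpow_one]]
        refine ENNReal.rpow_le_rpow ?_ (by positivity)
        refine (Finset.sum_le_card_nsmul _ _ (‖mu 0‖ₑ ^ p') fun k _ => ?_).trans ?_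
        · have : k.1 = 0 := Subsingleton.elim _ _
          rw [this]
          exact le_rfl
        · refine (nsmul_le_nsmul_left (zero_le) (m := 1) ?_).trans (one_nsmul _).le
          exact Finset.card_le_one.2 fun a _ b _ => Subsingleton.elim _ _
      · intro j hj
        simp [XjNorm, hj, hp'0]
  by_cases hC : C = ⊤
  · simp [hC]
  obtain ⟨ν, hν1, hν2⟩ := morrey_abstract_dual (I := ℕ × (Fin d → ℤ)) (K := Fin d → ℤ)
    (fun q => {k | inDyadic d q.1 q.2 k}) (hS := fun q => inDyadicFintype d q.1 q.2) p p' hpq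
    (fun q => ((2 : ℝ) ^ (q.1 * d)) ^ (1 / u - 1 / p)) (fun q => by positivity)
    (fun q => Real.rpow_le_one_of_one_le_of_nonpos (one_le_pow₀ (by norm_num)) hexp.le)
    (fun k => ⟨(0, fun i => k i / 2 ^ 0), (inDyadic_iff d 0 _ k).2 rfl⟩) mu C.toReal
    ENNReal.toReal_nonneg (by
      intro lam A hA
      have hA0 : 0 ≤ A := le_trans (by positivity) (hA (0, 0))
      have h1 : morreyNorm d u p lam ≤ ENNReal.ofReal A := by
        unfold morreyNorm
        refine iSup₂_le fun j m => ?_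
        rw [morrey_term _ _ _ _ hp0]
        exact ENNReal.ofReal_le_ofReal (hA (j, m))
      have h2 := (h lam).trans (mul_le_mul_right h1 C)
      rw [← ENNReal.ofReal_toReal hC, ← ENNReal.ofReal_mul ENNReal.toReal_nonneg,
        ← ofReal_norm] at h2
      exact (ENNReal.ofReal_le_ofReal_iff (by positivity)).1 h2)
  have hws : Summable fun j : ℕ => ((2 : ℝ) ^ (j * d)) ^ (1 / u - 1 / p) := by
    have h1 : ((2 : ℝ) ^ d) ^ (1 / u - 1 / p) < 1 :=
      Real.rpow_lt_one_of_one_lt_of_neg (one_lt_pow₀ (by norm_num) hd.ne') hexp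
    convert summable_geometric_of_lt_one (by positivity) h1 using 2 with j
    rw [mul_comm, pow_mul, ← Real.rpow_natCast, ← Real.rpow_natCast (_ ^ (1 / u - 1 / p)),
      ← Real.rpow_mul (by positivity), ← Real.rpow_mul (by positivity), mul_comm]
  unfold XupNorm
  refine iInf₂_le_of_le (fun j k => ((((2 : ℝ) ^ (j * d)) ^ (1 / u - 1 / p) : ℝ) : ℂ) *
    ν (j, fun i => k i / 2 ^ j) k) (fun k => ?_) ?_
  · refine hν2 k (fun j => (j, fun i => k i / 2 ^ j)) ?_ ?_ hws
    · intro a b hab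
      exact congrArg Prod.fst hab
    · rintro ⟨j, m⟩
      rw [Set.mem_ofPred_eq, inDyadic_iff]
      simp only [Set.mem_range, Prod.mk.injEq]
      constructor
      · intro hm
        exact ⟨j, rfl, hm⟩
      · rintro ⟨_, rfl, hm⟩
        exact hm
  · have hX : ∀ j, XjNorm d u p p' j (fun k => ((((2 : ℝ) ^ (j * d)) ^ (1 / u - 1 / p) : ℝ) : ℂ) *
        ν (j, fun i => k i / 2 ^ j) k) = ∑' m : Fin d → ℤ,
        (((∑ k : {k // inDyadic d j m k}, ‖ν (j, m) k‖₊ ^ p') ^ (1 / p') : ℝ≥0) : ℝ≥0∞) := by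
      intro j
      unfold XjNorm
      rw [← ENNReal.tsum_mul_left]
      refine tsum_congr fun m => ?_
      have hw : (‖((((2 : ℝ) ^ (j * d)) ^ (1 / u - 1 / p) : ℝ) : ℂ)‖ₑ) =
          ((2 : ℝ≥0∞) ^ (j * d)) ^ (1 / u - 1 / p) := by
        rw [← ofReal_norm, Complex.norm_real, Real.norm_of_nonneg (by positivity),
          ← ENNReal.ofReal_rpow_of_pos (by positivity), ENNReal.ofReal_pow (by positivity)]
        simp
      have hk : ∀ k : {k // inDyadic d j m k},
          ((‖((((2 : ℝ) ^ (j * d)) ^ (1 / u - 1 / p) : ℝ) : ℂ) *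
          ν (j, fun i => k.1 i / 2 ^ j) k‖₊ : ℝ≥0∞)) ^ p' =
          (((2 : ℝ≥0∞) ^ (j * d)) ^ (1 / u - 1 / p)) ^ p' * ‖ν (j, m) k‖ₑ ^ p' := by
        intro k
        rw [(inDyadic_iff d j m k).1 k.2, ← ENNReal.mul_rpow_of_nonneg _ _ hp'0.le, ← hw, ← enorm_mul]
        rfl
      simp only [hk]
      rw [ENNReal.tsum_mul_left, ENNReal.mul_rpow_of_nonneg _ _ (by positivity),
        ← ENNReal.rpow_mul _ p', mul_one_div_cancel hp'0.ne', ENNReal.rpow_one, ← mul_assoc,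
        mul_comm (_ ^ (1 / p - 1 / u)), weight_mul, one_mul, tsum_fintype,
        ENNReal.coe_rpow_of_nonneg _ (by positivity), ENNReal.ofNNReal_finsetSum]
      congr 1
      refine Finset.sum_congr rfl fun k _ => ?_
      rw [ENNReal.coe_rpow_of_nonneg _ hp'0.le]
      rfl
    simp only [hX]
    rw [← ENNReal.tsum_prod (f := fun (j : ℕ) (m : Fin d → ℤ) =>
        (((∑ k : {k // inDyadic d j m k}, ‖ν (j, m) k‖₊ ^ p') ^ (1 / p') : ℝ≥0) : ℝ≥0∞)),
      ENNReal.tsum_eq_iSup_sum]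
    refine iSup_le fun A => ?_
    rw [← ENNReal.ofReal_toReal hC]
    have := ENNReal.ofReal_le_ofReal (hν1 A)
    rw [← ENNReal.ofNNReal_finsetSum, ← ENNReal.ofReal_coe_nnreal]
    exact this

theorem dual_of_morrey00 (d : ℕ) (u p p' : ℝ)
    (hp : 1 ≤ p) (hpu : p < u) (hp'pos : 0 < p') (hp' : 1 / p + 1 / p' = 1) :
    (∀ f : ((Fin d → ℤ) → ℂ) → ℂ,
        (∀ lam mu : (Fin d → ℤ) → ℂ, MemMorrey00 d u p lam → MemMorrey00 d u p mu →
          f (lam + mu) = f lam + f mu) →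
        (∀ (c : ℂ) (lam : (Fin d → ℤ) → ℂ), MemMorrey00 d u p lam →
          f (c • lam) = c * f lam) →
        (∃ C : ℝ≥0∞, C ≠ ⊤ ∧ ∀ lam : (Fin d → ℤ) → ℂ, MemMorrey00 d u p lam →
          (‖f lam‖₊ : ℝ≥0∞) ≤ C * morreyNorm d u p lam) →
        ∃! mu : (Fin d → ℤ) → ℂ,
          XupNorm d u p p' mu ≠ ⊤ ∧
          (∀ lam : (Fin d → ℤ) → ℂ, MemMorrey00 d u p lam →
            HasSum (fun k => lam k * mu k) (f lam)) ∧
          (∀ lam : (Fin d → ℤ) → ℂ, MemMorrey00 d u p lam →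
            (‖f lam‖₊ : ℝ≥0∞) ≤ XupNorm d u p p' mu * morreyNorm d u p lam) ∧
          (∀ C : ℝ≥0∞, (∀ lam : (Fin d → ℤ) → ℂ, MemMorrey00 d u p lam →
              (‖f lam‖₊ : ℝ≥0∞) ≤ C * morreyNorm d u p lam) →
            XupNorm d u p p' mu ≤ C)) ∧
    (∀ mu : (Fin d → ℤ) → ℂ, XupNorm d u p p' mu ≠ ⊤ →
        (∀ lam : (Fin d → ℤ) → ℂ, MemMorrey00 d u p lam →
          Summable (fun k => lam k * mu k)) ∧
        (∀ lam : (Fin d → ℤ) → ℂ, MemMorrey00 d u p lam →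
          (‖∑' k, lam k * mu k‖₊ : ℝ≥0∞) ≤ XupNorm d u p p' mu * morreyNorm d u p lam) ∧
        (∀ C : ℝ≥0∞, (∀ lam : (Fin d → ℤ) → ℂ, MemMorrey00 d u p lam →
            (‖∑' k, lam k * mu k‖₊ : ℝ≥0∞) ≤ C * morreyNorm d u p lam) →
          XupNorm d u p p' mu ≤ C)) := by
  classical
  have hp0 : 0 < p := by linarith
  have hp1 : 1 < p := by
    rcases hp.lt_or_eq with h | h
    · exact h
    · subst h
      have : 0 < 1 / p' := by positivity
      linarith
  have hpq : p.HolderConjugate p' := by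
    rw [Real.holderConjugate_iff]
    exact ⟨hp1, by simpa using hp'⟩
  have hfs : ∀ lam : (Fin d → ℤ) →₀ ℂ, MemMorrey00 d u p lam := fun lam =>
    mem00_finite d u p hp0 hpu lam lam.hasFiniteSupport
  have hsummable : ∀ mu, XupNorm d u p p' mu ≠ ⊤ → ∀ lam, morreyNorm d u p lam ≠ ⊤ →
      Summable (fun k => lam k * mu k) := by
    intro mu hmu lam hlam
    have h1 := ne_top_of_le_ne_top (ENNReal.mul_ne_top hmu hlam)
      (dual_bound d u p p' hpq lam mu hlam hmu)
    refine Summable.of_norm ?_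
    have h2 := ENNReal.summable_toReal h1
    simpa using h2
  have hbound : ∀ mu, XupNorm d u p p' mu ≠ ⊤ → ∀ lam, morreyNorm d u p lam ≠ ⊤ →
      ‖∑' k, lam k * mu k‖ₑ ≤ XupNorm d u p p' mu * morreyNorm d u p lam := by
    intro mu hmu lam hlam
    exact enorm_tsum_le_tsum_enorm.trans (dual_bound d u p p' hpq lam mu hlam hmu)
  have hfts : ∀ (mu : (Fin d → ℤ) → ℂ) (lam : (Fin d → ℤ) →₀ ℂ),
      HasSum (fun k => lam k * mu k) (lam.sum (fun k z => z * mu k)) := by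
    intro mu lam
    refine hasSum_sum_of_ne_finset_zero fun k hk => ?_
    rw [Finsupp.notMem_support_iff.1 hk, zero_mul]
  constructor
  · intro f hadd hsmul ⟨C, hCtop, hC⟩
    let mu : (Fin d → ℤ) → ℂ := fun k => f (Finsupp.single k (1 : ℂ))
    have hf : ∀ lam : (Fin d → ℤ) →₀ ℂ, f lam = lam.sum (fun k z => z * mu k) := by
      intro lam
      induction lam using Finsupp.induction_linear with
      | zero =>
        have := hsmul 0 _ (hfs 0)
        simpa using this
      | add x y hx hy =>
        rw [Finsupp.coe_add, hadd _ _ (hfs x) (hfs y), hx, hy,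
          Finsupp.sum_add_index' (by simp) (by intros; ring)]
      | single k c =>
        have := hsmul c _ (hfs (Finsupp.single k 1))
        rw [← Finsupp.coe_smul, Finsupp.smul_single, smul_eq_mul, mul_one] at this
        rw [this, Finsupp.sum_single_index (by simp)]
    have hkey : ∀ C : ℝ≥0∞, (∀ lam : (Fin d → ℤ) → ℂ, MemMorrey00 d u p lam →
              (‖f lam‖₊ : ℝ≥0∞) ≤ C * morreyNorm d u p lam) →
            XupNorm d u p p' mu ≤ C := by
      intro C hC
      refine dual_key d u p p' hpq hpu mu C fun lam => ?_
      rw [← hf]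
      exact hC lam (hfs lam)
    have hmu : XupNorm d u p p' mu ≠ ⊤ := ne_top_of_le_ne_top hCtop (hkey C hC)
    have hsum : ∀ lam : (Fin d → ℤ) → ℂ, MemMorrey00 d u p lam →
            HasSum (fun k => lam k * mu k) (f lam) := by
      intro lam hlam
      have hs := hsummable mu hmu lam hlam.1
      suffices h : f lam = ∑' k, lam k * mu k by rw [h]; exact hs.hasSum
      rw [← sub_eq_zero, ← enorm_eq_zero]
      have hD : C + XupNorm d u p p' mu ≠ ⊤ := ENNReal.add_ne_top.2 ⟨hCtop, hmu⟩
      have key : ∀ ε : ℝ≥0∞, 0 < ε → ε ≠ ⊤ →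
          ‖f lam - ∑' k, lam k * mu k‖ₑ ≤ (C + XupNorm d u p p' mu) * ε := by
        intro ε hε hεt
        obtain ⟨x, hx, hxε⟩ := hlam.2 ε hε
        have hfin : morreyNorm d u p (lam - x) ≠ ⊤ := hxε.ne_top
        have h00 := mem00_sub d u p lam x hlam hx hfin
        let X : (Fin d → ℤ) →₀ ℂ := Finsupp.ofSupportFinite x hx
        have hX : (X : (Fin d → ℤ) → ℂ) = x := rfl
        have h1 : f lam = f (lam - x) + f x := by
          rw [← hadd _ _ h00 (hX ▸ hfs X), sub_add_cancel]
        have h2 : ∑' k, lam k * mu k = ∑' k, (lam - x) k * mu k + f x := by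
          have hfx : f x = X.sum (fun k z => z * mu k) := hf X
          rw [hfx, ← (hfts mu X).tsum_eq,
            ← (hsummable mu hmu _ hfin).tsum_add (hfts mu X).summable]
          refine tsum_congr fun k => ?_
          simp only [Pi.sub_apply, hX]
          ring
        rw [h1, h2, add_sub_add_right_eq_sub]
        calc ‖f (lam - x) - ∑' k, (lam - x) k * mu k‖ₑ
            ≤ ‖f (lam - x)‖ₑ + ‖∑' k, (lam - x) k * mu k‖ₑ := enorm_sub_le
          _ ≤ C * morreyNorm d u p (lam - x) + XupNorm d u p p' mu * morreyNorm d u p (lam - x) :=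
              add_le_add (hC _ h00) (hbound mu hmu _ hfin)
          _ = (C + XupNorm d u p p' mu) * morreyNorm d u p (lam - x) := by ring
          _ ≤ _ := by gcongr
      refine le_antisymm (le_of_forall_pos_le_add ?_) zero_le
      intro δ hδ
      rw [zero_add]
      by_cases hδt : δ = ⊤
      · simp [hδt]
      have hD1 : C + XupNorm d u p p' mu + 1 ≠ ⊤ := ENNReal.add_ne_top.2 ⟨hD, by simp⟩
      have hD0 : C + XupNorm d u p p' mu + 1 ≠ 0 := by simp
      refine (key (δ / (C + XupNorm d u p p' mu + 1)) (ENNReal.div_pos hδ.ne' hD1)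
        (ENNReal.div_ne_top hδt hD0)).trans ?_
      calc _ ≤ (C + XupNorm d u p p' mu + 1) * (δ / (C + XupNorm d u p p' mu + 1)) := by
            exact mul_le_mul' le_self_add le_rfl
        _ = δ := ENNReal.mul_div_cancel hD0 hD1
    refine ⟨mu, ⟨hmu, hsum, ?_, hkey⟩, ?_⟩
    · intro lam hlam
      rw [← (hsum lam hlam).tsum_eq]
      exact hbound mu hmu lam hlam.1
    · rintro y ⟨-, hy, -, -⟩
      funext k
      have h1 := hy _ (hfs (Finsupp.single k 1))
      have h2 := hfts y (Finsupp.single k 1)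
      have h3 := h1.unique h2
      rw [Finsupp.sum_single_index (by simp), one_mul] at h3
      exact h3.symm
  · intro mu hmu
    refine ⟨fun lam hlam => hsummable mu hmu lam hlam.1,
      fun lam hlam => hbound mu hmu lam hlam.1, fun C hC => ?_⟩
    refine dual_key d u p p' hpq hpu mu C fun lam => ?_
    rw [← (hfts mu lam).tsum_eq]
    exact hC lam (hfs lam)
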